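/- Let T = X + iY satisfy assumption (A) and let ψ be a real-valued function that is either in C¹₁([a,b]) or a polynomial. Then H − H₀ is trace class, where H₀ = X and H = e^{iψ(Y)} X e^{−iψ(Y)}; in fact H − H₀ = i ∫₀¹ e^{isψ(Y)} [ψ(Y), X] e^{−isψ(Y)} ds. Moreover, for every φ that is either in C¹₁([a,b]) or a polynomial, φ(H) − φ(H₀) is trace class and Tr(φ(H) − φ(H₀)) = i Tr([ψ(Y), φ(X)]). -/

import Mathlib

open scoped InnerProductSpace
open MeasureTheory Polynomial

namespace HHCP

variable {H : Type*} [NormedAddCommGroup H] [InnerProductSpace ℂ H] [CompleteSpace H]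
  [TopologicalSpace.SeparableSpace H]

/-- `f(A)` for a function `f` of a real variable, applied to the (selfadjoint, hence
star-normal) bounded operator `A` via the continuous functional calculus. -/
noncomputable def fc (f : ℝ → ℂ) (A : H →L[ℂ] H) : H →L[ℂ] H :=
  cfc (fun z : ℂ => f z.re) A

/-- `|A| = √(A⋆A)`. -/
noncomputable def absOp (A : H →L[ℂ] H) : H →L[ℂ] H :=
  cfc Real.sqrt (ContinuousLinearMap.adjoint A * A)

/-- `A` is of trace class, i.e. `∑ ⟪eᵢ, |A| eᵢ⟫ < ∞` (this is independent of the
choice of the Hilbert basis `e`). -/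
def IsTraceClass {ι : Type*} (e : HilbertBasis ι ℂ H) (A : H →L[ℂ] H) : Prop :=
  Summable fun i => (⟪e i, absOp A (e i)⟫_ℂ).re

/-- The trace norm `‖A‖₁ = Tr |A|`. -/
noncomputable def traceNorm {ι : Type*} (e : HilbertBasis ι ℂ H) (A : H →L[ℂ] H) : ℝ :=
  ∑' i, (⟪e i, absOp A (e i)⟫_ℂ).re

/-- The trace `Tr A = ∑ᵢ ⟪eᵢ, A eᵢ⟫`. -/
noncomputable def trace {ι : Type*} (e : HilbertBasis ι ℂ H) (A : H →L[ℂ] H) : ℂ :=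
  ∑' i, ⟪e i, A (e i)⟫_ℂ

/-- `T` is hyponormal (`‖T⋆x‖ ≤ ‖Tx‖`, i.e. `[T⋆,T] ≥ 0`) and *purely* so: there is no
nonzero closed subspace, invariant under `T` and `T⋆`, on which `T` is normal. -/
def PurelyHyponormal (T : H →L[ℂ] H) : Prop :=
  (∀ x : H, ‖ContinuousLinearMap.adjoint T x‖ ≤ ‖T x‖) ∧
  ∀ S : Submodule ℂ H, IsClosed (S : Set H) →
    (∀ x ∈ S, T x ∈ S) → (∀ x ∈ S, ContinuousLinearMap.adjoint T x ∈ S) →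
    (∀ x ∈ S, ‖T x‖ = ‖ContinuousLinearMap.adjoint T x‖) → S = ⊥

/-- Assumption (A): `T = X + iY` is purely hyponormal with `X, Y` selfadjoint,
`[T⋆,T] = −2i[Y,X] = 2D²` is a positive trace-class operator, and
`σ(X) ∪ σ(Y) ⊆ [a,b]`. -/
structure AssumptionA {ι : Type*} (e : HilbertBasis ι ℂ H)
    (X Y D2 : H →L[ℂ] H) (a b : ℝ) : Prop where
  hab : a ≤ b
  hX : IsSelfAdjoint X
  hY : IsSelfAdjoint Y
  hpure : PurelyHyponormal (X + Complex.I • Y)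
  hD2 : (2 : ℂ) • D2 = (-(2 : ℂ) * Complex.I) • (Y * X - X * Y)
  hpos : D2.IsPositive
  htc : IsTraceClass e D2
  hspecX : spectrum ℝ X ⊆ Set.Icc a b
  hspecY : spectrum ℝ Y ⊆ Set.Icc a b

/-- `ψ ∈ C¹₁`: `ψ(β) = (2π)^{-1/2} ∫ ψ̂(α) e^{iαβ} dα` for some `ψ̂` with
`∫ |ψ̂(α)|(1+|α|) dα < ∞`. -/
def MemC11 (ψ : ℝ → ℂ) : Prop :=
  ∃ g : ℝ → ℂ, Integrable g ∧ Integrable (fun α : ℝ => α • g α) ∧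
    ∀ β : ℝ, ψ β = (Real.sqrt (2 * Real.pi))⁻¹ •
      ∫ α : ℝ, Complex.exp (Complex.I * (α : ℂ) * (β : ℂ)) • g α

/-- `ψ` is (the function given by) a polynomial with complex coefficients. -/
def IsPolyFun (ψ : ℝ → ℂ) : Prop :=
  ∃ p : Polynomial ℂ, ∀ t : ℝ, ψ t = Polynomial.eval (t : ℂ) p

/-- `ψ` is either in `C¹₁([a,b])` or a polynomial. -/
def GoodFun (ψ : ℝ → ℂ) : Prop := MemC11 ψ ∨ IsPolyFun ψ

/-- `E` is the spectral measure of the selfadjoint operator `A`: a projection-valued,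
countably additive measure on `ℝ` such that `⟪x, f(A) x⟫ = ∫ f dμ_x`, where `μ_x` is the
finite positive measure `μ_x(Δ) = ⟪x, E(Δ) x⟫`. -/
def IsSpectralMeasureOf (A : H →L[ℂ] H) (E : Set ℝ → H →L[ℂ] H) : Prop :=
  (∀ Δ : Set ℝ, IsSelfAdjoint (E Δ)) ∧
  (∀ Δ Ω : Set ℝ, E (Δ ∩ Ω) = E Δ * E Ω) ∧
  E Set.univ = 1 ∧
  (∀ Δ : ℕ → Set ℝ, (∀ n, MeasurableSet (Δ n)) → Pairwise (Function.onFun Disjoint Δ) →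
    ∀ x : H, HasSum (fun n => E (Δ n) x) (E (⋃ n, Δ n) x)) ∧
  ∀ x : H, ∃ μ : Measure ℝ, IsFiniteMeasure μ ∧
    (∀ Δ : Set ℝ, MeasurableSet Δ → (μ Δ).toReal = (⟪x, E Δ x⟫_ℂ).re) ∧
    ∀ f : ℝ → ℝ, Continuous f → (⟪x, cfc f A x⟫_ℂ).re = ∫ t, f t ∂μ

/-- An indefinite integral `𝒥(χ_Δ)` of the characteristic function of `Δ`. -/
noncomputable def Jind (a : ℝ) (Δ : Set ℝ) (t : ℝ) : ℝ :=
  ∫ s in a..t, Set.indicator Δ (fun _ => (1 : ℝ)) s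

/-- `𝒥(χ_Δ)(A)`. -/
noncomputable def JindOp (a : ℝ) (Δ : Set ℝ) (A : H →L[ℂ] H) : H →L[ℂ] H :=
  fc (fun t => (Jind a Δ t : ℂ)) A

/-- `ψ ∈ C¹([a,b])` with derivative `ψd` on `[a,b]`. -/
def HasDerivOnIcc (ψ ψd : ℝ → ℂ) (a b : ℝ) : Prop :=
  (∀ t ∈ Set.Icc a b, HasDerivWithinAt ψ (ψd t) (Set.Icc a b) t) ∧
  ContinuousOn ψd (Set.Icc a b)

/-- `r` is a Carey–Pincus principal function for the pair `X, Y`: a nonnegative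
`L¹([a,b]²)` function with `Tr(−i[ψ(Y), φ(X)]) = ∫∫ φ′(t) ψ′(λ) r(t,λ) dt dλ`
for all `ψ, φ ∈ C¹([a,b])`. -/
def IsPrincipalFunction {ι : Type*} (e : HilbertBasis ι ℂ H) (X Y : H →L[ℂ] H)
    (a b : ℝ) (r : ℝ → ℝ → ℝ) : Prop :=
  IntegrableOn (fun q : ℝ × ℝ => r q.1 q.2) (Set.Icc a b ×ˢ Set.Icc a b) ∧
  (∀ᵐ q : ℝ × ℝ ∂(volume : Measure (ℝ × ℝ)),
    q ∈ Set.Icc a b ×ˢ Set.Icc a b → 0 ≤ r q.1 q.2) ∧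
  ∀ ψ ψd φ φd : ℝ → ℂ, HasDerivOnIcc ψ ψd a b → HasDerivOnIcc φ φd a b →
    trace e ((-Complex.I) • (fc ψ Y * fc φ X - fc φ X * fc ψ Y)) =
      ∫ t in Set.Icc a b, ∫ l in Set.Icc a b, φd t * ψd l * (r t l : ℂ)

/-- The Jacobian `J(F,G)(t,λ) = ∂F/∂t ∂G/∂λ − ∂F/∂λ ∂G/∂t`. -/
noncomputable def Jac (F G : ℝ → ℝ → ℂ) (t l : ℝ) : ℂ :=
  deriv (fun s => F s l) t * deriv (fun s => G t s) l -
    deriv (fun s => F t s) l * deriv (fun s => G s l) t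

/-- `e^{isψ(Y)}`, the unitary obtained by functional calculus. -/
noncomputable def expIpsi (ψ : ℝ → ℂ) (s : ℝ) (Y : H →L[ℂ] H) : H →L[ℂ] H :=
  fc (fun t => Complex.exp (Complex.I * (s : ℂ) * ψ t)) Y

set_option linter.unusedSectionVars false

local notation "adj" => ContinuousLinearMap.adjoint

/-- Quantitative trace class membership, together with cyclicity of the trace. -/
def TCB {ι : Type*} (e : HilbertBasis ι ℂ H) (M : ℝ) (A : H →L[ℂ] H) : Prop :=
  (∀ (B C : H →L[ℂ] H) (s : Finset ι),
    ∑ i ∈ s, ‖⟪e i, (B * A * C) (e i)⟫_ℂ‖ ≤ M * (‖B‖ * ‖C‖)) ∧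
  ∀ B C : H →L[ℂ] H, trace e (B * A * C) = trace e (C * B * A)

section basic
variable {ι : Type*} {e : HilbertBasis ι ℂ H}

lemma countable_index (e : HilbertBasis ι ℂ H) : Countable ι := by
  have ho := e.orthonormal
  have hpd : (Set.univ : Set ι).PairwiseDisjoint (fun i => Metric.ball (e i) (1/2)) := by
    intro i _ j _ hij
    refine Metric.ball_disjoint_ball ?_
    have h2 : ‖e i - e j‖ ^ 2 = 2 := by
      rw [@norm_sub_sq ℂ, ho.1 i, ho.1 j, ho.2 hij]; norm_num
    rw [dist_eq_norm]
    nlinarith [norm_nonneg (e i - e j)]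
  have := hpd.countable_of_isOpen (fun i _ => Metric.isOpen_ball)
    (fun i _ => ⟨e i, Metric.mem_ball_self (by norm_num)⟩)
  exact Set.countable_univ_iff.mp this

lemma hasSum_sq (e : HilbertBasis ι ℂ H) (x : H) :
    HasSum (fun j => ‖⟪e j, x⟫_ℂ‖ ^ 2) (‖x‖ ^ 2) := by
  have h := e.hasSum_inner_mul_inner x x
  have h2 := Complex.hasSum_re h
  convert h2 using 1
  · ext j
    rw [← inner_conj_symm x (e j), ← Complex.normSq_eq_conj_mul_self, Complex.ofReal_re,
      Complex.normSq_eq_norm_sq]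
  · rw [← inner_self_eq_norm_sq (𝕜 := ℂ)]; rfl

lemma hs_prod (e : HilbertBasis ι ℂ H) (R C : H →L[ℂ] H) (hR : adj R = R)
    (hS : Summable fun j => ‖R (e j)‖ ^ 2) :
    Summable (fun p : ι × ι => ‖⟪e p.2, (R * C) (e p.1)⟫_ℂ‖ ^ 2) ∧
    (Summable fun i => ‖(R * C) (e i)‖ ^ 2) ∧
    ∑' i, ‖(R * C) (e i)‖ ^ 2 ≤ ‖C‖ ^ 2 * ∑' j, ‖R (e j)‖ ^ 2 := by
  have hk : ∀ i j, ‖⟪e j, (R * C) (e i)⟫_ℂ‖ = ‖⟪e i, (adj C) (R (e j))⟫_ℂ‖ := by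
    intro i j
    rw [mul_apply_eq_comp, ContinuousLinearMap.adjoint_inner_right,
      ← ContinuousLinearMap.adjoint_inner_left, hR, norm_inner_symm]
  have hle : ∀ j, ‖(adj C) (R (e j))‖ ^ 2 ≤ ‖C‖ ^ 2 * ‖R (e j)‖ ^ 2 := by
    intro j
    have := (adj C).le_opNorm (R (e j))
    rw [LinearIsometryEquiv.norm_map] at this
    rw [← mul_pow]
    gcongr
  have hS2 : Summable fun j => ‖(adj C) (R (e j))‖ ^ 2 :=
    Summable.of_nonneg_of_le (fun _ => by positivity) hle (hS.mul_left _)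
  have h1 : Summable (fun p : ι × ι => ‖⟪e p.1, (R * C) (e p.2)⟫_ℂ‖ ^ 2) := by
    rw [summable_prod_of_nonneg (fun _ => by positivity)]
    constructor
    · intro j
      simp only [hk]
      exact (hasSum_sq e _).summable
    · simp only [hk]
      simpa only [(hasSum_sq e _).tsum_eq] using hS2
  have h2 : Summable (fun p : ι × ι => ‖⟪e p.2, (R * C) (e p.1)⟫_ℂ‖ ^ 2) :=
    h1.prod_symm
  refine ⟨h2, ?_, ?_⟩
  · have := ((summable_prod_of_nonneg (fun _ => by positivity)).mp h2).2
    simpa only [(hasSum_sq e _).tsum_eq] using this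
  · calc ∑' i, ‖(R * C) (e i)‖ ^ 2 = ∑' i, ∑' j, ‖⟪e j, (R * C) (e i)⟫_ℂ‖ ^ 2 := by
          simp only [(hasSum_sq e _).tsum_eq]
      _ = ∑' j, ∑' i, ‖⟪e j, (R * C) (e i)⟫_ℂ‖ ^ 2 :=
          Summable.tsum_comm (f := fun j i => ‖⟪e j, (R * C) (e i)⟫_ℂ‖ ^ 2) h1
      _ = ∑' j, ‖(adj C) (R (e j))‖ ^ 2 := by
          simp only [hk, (hasSum_sq e _).tsum_eq]
      _ ≤ ∑' j, ‖C‖ ^ 2 * ‖R (e j)‖ ^ 2 := hS2.tsum_le_tsum hle (hS.mul_left _)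
      _ = _ := tsum_mul_left

lemma tcb_base (e : HilbertBasis ι ℂ H) (R : H →L[ℂ] H) (hR : adj R = R)
    (hS : Summable fun j => ‖R (e j)‖ ^ 2) :
    TCB e (∑' j, ‖R (e j)‖ ^ 2) (R * R) := by
  have hRi : ∀ x y, ⟪x, R y⟫_ℂ = ⟪R x, y⟫_ℂ := fun x y => by
    rw [← ContinuousLinearMap.adjoint_inner_left, hR]
  have hS0 : 0 ≤ ∑' j, ‖R (e j)‖ ^ 2 := tsum_nonneg fun _ => by positivity
  have hin : ∀ (B C : H →L[ℂ] H) i,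
      ⟪e i, (B * (R * R) * C) (e i)⟫_ℂ = ⟪(R * adj B) (e i), (R * C) (e i)⟫_ℂ := by
    intro B C i
    simp only [mul_apply_eq_comp]
    rw [← ContinuousLinearMap.adjoint_inner_left, hRi]
  constructor
  · intro B C s
    obtain ⟨-, hb1, hb2⟩ := hs_prod e R (adj B) hR hS
    obtain ⟨-, hc1, hc2⟩ := hs_prod e R C hR hS
    rw [LinearIsometryEquiv.norm_map] at hb2
    calc ∑ i ∈ s, ‖⟪e i, (B * (R * R) * C) (e i)⟫_ℂ‖
        ≤ ∑ i ∈ s, ‖(R * adj B) (e i)‖ * ‖(R * C) (e i)‖ := by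
          refine Finset.sum_le_sum fun i _ => ?_
          rw [hin]; exact norm_inner_le_norm _ _
      _ ≤ √(∑ i ∈ s, ‖(R * adj B) (e i)‖ ^ 2) * √(∑ i ∈ s, ‖(R * C) (e i)‖ ^ 2) :=
          Real.sum_mul_le_sqrt_mul_sqrt _ _ _
      _ ≤ √(‖B‖ ^ 2 * ∑' j, ‖R (e j)‖ ^ 2) * √(‖C‖ ^ 2 * ∑' j, ‖R (e j)‖ ^ 2) := by
          gcongr
          · exact (hb1.sum_le_tsum s fun _ _ => by positivity).trans hb2
          · exact (hc1.sum_le_tsum s fun _ _ => by positivity).trans hc2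
      _ = _ := by
          rw [Real.sqrt_mul (by positivity), Real.sqrt_mul (by positivity),
            Real.sqrt_sq (norm_nonneg _), Real.sqrt_sq (norm_nonneg _)]
          rw [mul_mul_mul_comm, Real.mul_self_sqrt hS0]; ring
  · have key : ∀ B C : H →L[ℂ] H, trace e (B * (R * R) * C) = trace e (R * (C * B) * R) := by
      intro B C
      obtain ⟨hb, -⟩ := hs_prod e R (adj B) hR hS
      obtain ⟨hc, -⟩ := hs_prod e R C hR hS
      have hsum : Summable (fun p : ι × ι =>
          ⟪(R * adj B) (e p.1), e p.2⟫_ℂ * ⟪e p.2, (R * C) (e p.1)⟫_ℂ) := by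
        refine Summable.of_norm_bounded (hb.add hc) fun p => ?_
        rw [norm_mul, norm_inner_symm]
        nlinarith [sq_nonneg (‖⟪e p.2, (R * adj B) (e p.1)⟫_ℂ‖ - ‖⟪e p.2, (R * C) (e p.1)⟫_ℂ‖),
          sq_nonneg (‖⟪e p.2, (R * adj B) (e p.1)⟫_ℂ‖), sq_nonneg ‖⟪e p.2, (R * C) (e p.1)⟫_ℂ‖]
      unfold trace
      calc ∑' i, ⟪e i, (B * (R * R) * C) (e i)⟫_ℂ
          = ∑' i, ∑' j, ⟪(R * adj B) (e i), e j⟫_ℂ * ⟪e j, (R * C) (e i)⟫_ℂ := by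
            simp only [hin, e.tsum_inner_mul_inner]
        _ = ∑' j, ∑' i, ⟪(R * adj B) (e i), e j⟫_ℂ * ⟪e j, (R * C) (e i)⟫_ℂ :=
            Summable.tsum_comm
              (f := fun j i => ⟪(R * adj B) (e i), e j⟫_ℂ * ⟪e j, (R * C) (e i)⟫_ℂ) hsum.prod_symm
        _ = ∑' j, ∑' i, ⟪(adj C) (R (e j)), e i⟫_ℂ * ⟪e i, B (R (e j))⟫_ℂ := by
            refine tsum_congr fun j => tsum_congr fun i => ?_
            rw [mul_comm]
            congr 1
            · rw [ContinuousLinearMap.adjoint_inner_left, mul_apply_eq_comp, hRi]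
            · rw [mul_apply_eq_comp, ← hRi, ContinuousLinearMap.adjoint_inner_left]
        _ = _ := by
            refine tsum_congr fun j => ?_
            rw [e.tsum_inner_mul_inner, ContinuousLinearMap.adjoint_inner_left]
            simp only [mul_apply_eq_comp]
            rw [hRi]
    intro B C
    rw [key B C]
    have := key (C * B) 1
    rw [mul_one, one_mul] at this
    exact this.symm

end basic

section ops
variable {ι : Type*} {e : HilbertBasis ι ℂ H}

lemma TCB.summable {M : ℝ} {A : H →L[ℂ] H} (h : TCB e M A) :
    Summable fun i => ⟪e i, A (e i)⟫_ℂ := by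
  refine Summable.of_norm (summable_of_sum_le (c := M * (‖(1 : H →L[ℂ] H)‖ * ‖(1 : H →L[ℂ] H)‖))
    (fun _ => norm_nonneg _) fun s => ?_)
  simpa using h.1 1 1 s

lemma TCB.mono {M N : ℝ} {A : H →L[ℂ] H} (h : TCB e M A) (hMN : M ≤ N) : TCB e N A :=
  ⟨fun B C s => (h.1 B C s).trans (by gcongr), h.2⟩

lemma TCB.mul {M : ℝ} {A : H →L[ℂ] H} (h : TCB e M A) (hM : 0 ≤ M) (B C : H →L[ℂ] H) :
    TCB e (M * (‖B‖ * ‖C‖)) (B * A * C) := by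
  constructor
  · intro B' C' s
    have := h.1 (B' * B) (C * C') s
    rw [show B' * (B * A * C) * C' = B' * B * A * (C * C') by simp only [mul_assoc]]
    refine this.trans ?_
    have h1 := norm_mul_le B' B
    have h2 := norm_mul_le C C'
    calc M * (‖B' * B‖ * ‖C * C'‖) ≤ M * ((‖B'‖ * ‖B‖) * (‖C‖ * ‖C'‖)) := by gcongr
      _ = _ := by ring
  · intro B' C'
    rw [show B' * (B * A * C) * C' = (B' * B) * A * (C * C') by simp only [mul_assoc], h.2,
      show C' * B' * (B * A * C) = (C' * B' * B) * A * C by simp only [mul_assoc], h.2]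
    simp only [mul_assoc]

lemma TCB.mulLeft {M : ℝ} {A : H →L[ℂ] H} (h : TCB e M A) (hM : 0 ≤ M) (B : H →L[ℂ] H) :
    ∃ N, 0 ≤ N ∧ TCB e N (B * A) :=
  ⟨M * (‖B‖ * ‖(1 : H →L[ℂ] H)‖), by positivity, by simpa using h.mul hM B 1⟩

lemma TCB.mulRight {M : ℝ} {A : H →L[ℂ] H} (h : TCB e M A) (hM : 0 ≤ M) (B : H →L[ℂ] H) :
    ∃ N, 0 ≤ N ∧ TCB e N (A * B) :=
  ⟨M * (‖(1 : H →L[ℂ] H)‖ * ‖B‖), by positivity, by simpa using h.mul hM 1 B⟩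

lemma TCB.smul {M : ℝ} {A : H →L[ℂ] H} (h : TCB e M A) (c : ℂ) :
    TCB e (‖c‖ * M) (c • A) := by
  constructor
  · intro B C s
    have := h.1 B C s
    simp only [mul_smul_comm, smul_mul_assoc, smul_apply, inner_smul_right,
      norm_mul, ← Finset.mul_sum]
    rw [mul_assoc ‖c‖]
    exact mul_le_mul_of_nonneg_left this (norm_nonneg c)
  · intro B C
    have := h.2 B C
    unfold trace at this ⊢
    simp only [mul_smul_comm, smul_mul_assoc, smul_apply, inner_smul_right,
      tsum_mul_left, this]

lemma trace_smul (A : H →L[ℂ] H) (c : ℂ) : trace e (c • A) = c * trace e A := by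
  unfold trace
  simp only [smul_apply, inner_smul_right, tsum_mul_left]

lemma TCB.summable' {M : ℝ} {A : H →L[ℂ] H} (h : TCB e M A) (B C : H →L[ℂ] H) :
    Summable fun i => ⟪e i, (B * A * C) (e i)⟫_ℂ :=
  Summable.of_norm (summable_of_sum_le (fun _ => norm_nonneg _) (h.1 B C))

lemma TCB.add {M N : ℝ} {A A' : H →L[ℂ] H} (h : TCB e M A) (h' : TCB e N A') :
    TCB e (M + N) (A + A') := by
  constructor
  · intro B C s
    calc _ ≤ ∑ i ∈ s, (‖⟪e i, (B * A * C) (e i)⟫_ℂ‖ + ‖⟪e i, (B * A' * C) (e i)⟫_ℂ‖) := by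
          refine Finset.sum_le_sum fun i _ => ?_
          rw [mul_add, add_mul, add_apply, inner_add_right]
          exact norm_add_le _ _
      _ ≤ _ := by
          rw [Finset.sum_add_distrib, add_mul]
          exact add_le_add (h.1 B C s) (h'.1 B C s)
  · intro B C
    have e1 : trace e (B * (A + A') * C) = trace e (B * A * C) + trace e (B * A' * C) := by
      unfold trace
      rw [← (h.summable' B C).tsum_add (h'.summable' B C)]
      refine tsum_congr fun i => ?_
      rw [mul_add, add_mul, add_apply, inner_add_right]
    have e2 : trace e (C * B * (A + A')) = trace e (C * B * A) + trace e (C * B * A') := by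
      unfold trace
      have s1 := h.summable' (C * B) 1
      have s2 := h'.summable' (C * B) 1
      rw [mul_one] at s1 s2
      rw [← s1.tsum_add s2]
      refine tsum_congr fun i => ?_
      rw [mul_add, add_apply, inner_add_right]
    rw [e1, e2, h.2, h'.2]

lemma trace_integral_aux {Ω : Type*} [MeasurableSpace Ω] {μ : Measure Ω} (e : HilbertBasis ι ℂ H)
    {F : Ω → H →L[ℂ] H} (hF : Integrable F μ) {m : Ω → ℝ} (hm : Integrable m μ)
    (hb : ∀ w (s : Finset ι), ∑ i ∈ s, ‖⟪e i, F w (e i)⟫_ℂ‖ ≤ m w) :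
    (∀ s : Finset ι, ∑ i ∈ s, ‖⟪e i, (∫ w, F w ∂μ) (e i)⟫_ℂ‖ ≤ ∫ w, m w ∂μ) ∧
    trace e (∫ w, F w ∂μ) = ∫ w, trace e (F w) ∂μ := by
  have : Countable ι := countable_index e
  have hint : ∀ i, Integrable (fun w => ⟪e i, F w (e i)⟫_ℂ) μ := fun i =>
    (hF.apply_continuousLinearMap (e i)).const_inner (e i)
  have hev : ∀ i, ⟪e i, (∫ w, F w ∂μ) (e i)⟫_ℂ = ∫ w, ⟪e i, F w (e i)⟫_ℂ ∂μ := by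
    intro i
    rw [ContinuousLinearMap.integral_apply hF, integral_inner (hF.apply_continuousLinearMap (e i))]
  have hfin : ∀ s : Finset ι, ∑ i ∈ s, ∫ w, ‖⟪e i, F w (e i)⟫_ℂ‖ ∂μ ≤ ∫ w, m w ∂μ := by
    intro s
    rw [← integral_finsetSum _ fun i _ => (hint i).norm]
    exact integral_mono (integrable_finsetSum _ fun i _ => (hint i).norm) hm fun w => hb w s
  constructor
  · intro s
    refine le_trans (Finset.sum_le_sum fun i _ => ?_) (hfin s)
    rw [hev]
    exact norm_integral_le_integral_norm _
  · have hsum : Summable fun i => ∫ w, ‖⟪e i, F w (e i)⟫_ℂ‖ ∂μ :=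
      summable_of_sum_le (fun i => integral_nonneg fun _ => norm_nonneg _) hfin
    unfold trace
    simp only [hev]
    exact (hasSum_integral_of_summable_integral_norm hint hsum).tsum_eq

lemma TCB.integral {Ω : Type*} [MeasurableSpace Ω] {μ : Measure Ω}
    {F : Ω → H →L[ℂ] H} (hF : Integrable F μ) {m : Ω → ℝ} (hm : Integrable m μ)
    (hb : ∀ w, TCB e (m w) (F w)) :
    TCB e (∫ w, m w ∂μ) (∫ w, F w ∂μ) ∧ trace e (∫ w, F w ∂μ) = ∫ w, trace e (F w) ∂μ := by
  have hI : ∀ B C : H →L[ℂ] H, Integrable (fun w => B * F w * C) μ := fun B C =>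
    (hF.const_mul B).mul_const C
  have hIe : ∀ B C : H →L[ℂ] H, B * (∫ w, F w ∂μ) * C = ∫ w, B * F w * C ∂μ := fun B C => by
    rw [integral_mul_const_of_integrable (hF.const_mul B), integral_const_mul_of_integrable hF]
  have aux := fun B C : H →L[ℂ] H => trace_integral_aux e (hI B C) (hm.mul_const (‖B‖ * ‖C‖))
    (fun w => (hb w).1 B C)
  have hone : ∀ B : H →L[ℂ] H, trace e (B * (∫ w, F w ∂μ)) = ∫ w, trace e (B * F w) ∂μ := by
    intro B
    have := (aux B 1).2
    rw [← hIe B 1] at this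
    simpa only [mul_one] using this
  refine ⟨⟨?_, ?_⟩, ?_⟩
  · intro B C s
    rw [hIe B C, ← integral_mul_const]
    exact (aux B C).1 s
  · intro B C
    rw [hone, hIe, (aux B C).2]
    exact integral_congr_ae (.of_forall fun w => (hb w).2 B C)
  · simpa using hone 1

lemma adj_eq_star (A : H →L[ℂ] H) : adj A = star A := rfl

lemma TCB.isTraceClass {M : ℝ} {A : H →L[ℂ] H} (h : TCB e M A) : IsTraceClass e A := by
  unfold IsTraceClass
  set P : H →L[ℂ] H := adj A * A with hP
  have hPsa : IsSelfAdjoint P := IsSelfAdjoint.star_mul_self A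
  have hspec : ∀ t ∈ spectrum ℝ P, 0 ≤ t := by
    have : 0 ≤ P := star_mul_self_nonneg A
    exact fun t ht => spectrum_nonneg_of_nonneg this ht
  have hnn : 0 ≤ absOp A := cfc_nonneg fun t _ => Real.sqrt_nonneg t
  have hpos : (absOp A).IsPositive := (ContinuousLinearMap.nonneg_iff_isPositive _).mp hnn
  have hM : 0 ≤ M * (1 * ‖(1 : H →L[ℂ] H)‖) := by
    by_contra hcon
    have := h.1 1 1 ∅
    rw [Finset.sum_empty] at this
    rcases eq_or_ne (‖(1 : H →L[ℂ] H)‖) 0 with h0 | h0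
    · simp [h0] at hcon
    · have h1 : 0 < ‖(1 : H →L[ℂ] H)‖ := lt_of_le_of_ne (norm_nonneg _) h0.symm
      rw [← mul_assoc] at this
      rw [one_mul] at hcon
      exact hcon (nonneg_of_mul_nonneg_left this h1)
  have hM0 : 0 ≤ M * ‖(1 : H →L[ℂ] H)‖ := by simpa using hM
  refine summable_of_sum_le (c := M * ‖(1 : H →L[ℂ] H)‖) (fun i => ?_) fun s => ?_
  · exact hpos.re_inner_nonneg_right (e i)
  · refine le_of_forall_pos_le_add fun δ hδ => ?_
    obtain ⟨ε, hε, hεs⟩ : ∃ ε : ℝ, 0 < ε ∧ (s.card : ℝ) * ε ≤ δ := by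
      refine ⟨δ / (s.card + 1), by positivity, ?_⟩
      rw [mul_div_assoc', div_le_iff₀ (by positivity)]
      nlinarith
    have hc : Continuous fun t : ℝ => (√t + ε)⁻¹ :=
      Continuous.inv₀ (by fun_prop) fun t => by positivity
    have hc2 : Continuous fun t : ℝ => (√t + ε)⁻¹ * t := hc.mul continuous_id
    set G : H →L[ℂ] H := cfc (fun t : ℝ => (√t + ε)⁻¹) P with hG
    have hGsa : star G = G := (cfc_predicate _ _ : IsSelfAdjoint _)
    have hB : ‖G * star A‖ ≤ 1 := by
      have h2 : (G * star A) * star (G * star A) = cfc (fun t : ℝ => (√t + ε)⁻¹ * t * (√t + ε)⁻¹) P := by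
        rw [star_mul, star_star, hGsa]
        rw [cfc_mul _ _ P hc2.continuousOn hc.continuousOn,
          cfc_mul _ _ P hc.continuousOn (by fun_prop), cfc_id' ℝ P]
        rw [← hG, hP, adj_eq_star]
        simp only [mul_assoc]
      have h3 : ‖(G * star A) * star (G * star A)‖ ≤ 1 := by
        rw [h2]
        refine norm_cfc_le zero_le_one fun t ht => ?_
        have ht0 := hspec t ht
        have hs := Real.sq_sqrt ht0
        have hs0 := Real.sqrt_nonneg t
        rw [Real.norm_of_nonneg (by positivity)]
        rw [inv_mul_eq_div, ← div_eq_mul_inv, div_div, div_le_one (by positivity)]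
        nlinarith
      rw [CStarRing.norm_self_mul_star] at h3
      nlinarith [norm_nonneg (G * star A)]
    have hclose : ‖absOp A - G * star A * A‖ ≤ ε := by
      have h2 : absOp A - G * star A * A = cfc (fun t : ℝ => √t - (√t + ε)⁻¹ * t) P := by
        rw [cfc_sub _ _ P Real.continuous_sqrt.continuousOn hc2.continuousOn,
          cfc_mul _ _ P hc.continuousOn (by fun_prop), cfc_id' ℝ P, ← hG, mul_assoc]
        rfl
      rw [h2]
      refine norm_cfc_le hε.le fun t ht => ?_
      have ht0 := hspec t ht
      have hs := Real.sq_sqrt ht0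
      have hs0 := Real.sqrt_nonneg t
      have : √t - (√t + ε)⁻¹ * t = (√t * ε) / (√t + ε) := by
        field_simp
        nlinarith
      rw [this, Real.norm_of_nonneg (by positivity), div_le_iff₀ (by positivity)]
      nlinarith
    have hterm : ∀ i, (⟪e i, absOp A (e i)⟫_ℂ).re
        ≤ ‖⟪e i, (G * star A * A * 1) (e i)⟫_ℂ‖ + ε := by
      intro i
      have : absOp A (e i) = (G * star A * A * 1) (e i) + (absOp A - G * star A * A) (e i) := by
        simp
      rw [this, inner_add_right, Complex.add_re]
      refine add_le_add (Complex.re_le_norm _) ((Complex.re_le_norm _).trans ?_)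
      refine (norm_inner_le_norm _ _).trans ?_
      rw [e.orthonormal.1 i, one_mul]
      refine (ContinuousLinearMap.le_opNorm _ _).trans ?_
      rw [e.orthonormal.1 i, mul_one]
      exact hclose
    calc _ ≤ ∑ i ∈ s, (‖⟪e i, (G * star A * A * 1) (e i)⟫_ℂ‖ + ε) :=
          Finset.sum_le_sum fun i _ => hterm i
      _ = ∑ i ∈ s, ‖⟪e i, (G * star A * A * 1) (e i)⟫_ℂ‖ + s.card * ε := by
          rw [Finset.sum_add_distrib, Finset.sum_const, nsmul_eq_mul]
      _ ≤ M * (‖G * star A‖ * ‖(1 : H →L[ℂ] H)‖) + δ := add_le_add (h.1 _ _ s) hεs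
      _ ≤ M * ‖(1 : H →L[ℂ] H)‖ + δ := by
          have : M * (‖G * star A‖ * ‖(1 : H →L[ℂ] H)‖)
            = ‖G * star A‖ * (M * ‖(1 : H →L[ℂ] H)‖) := by ring
          rw [this]
          nlinarith

lemma tcb_of_pos (D : H →L[ℂ] H) (hD : D.IsPositive) (htc : IsTraceClass e D) :
    ∃ M, 0 ≤ M ∧ TCB e M D := by
  have hD0 : 0 ≤ D := (ContinuousLinearMap.nonneg_iff_isPositive _).mpr hD
  have hsa : IsSelfAdjoint D := hD.isSelfAdjoint
  have habs : absOp D = D := by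
    have : absOp D = cfc Real.sqrt (cfc (fun t : ℝ => t * t) D) := by
      rw [cfc_mul _ _ D (by fun_prop) (by fun_prop), cfc_id' ℝ D]
      unfold absOp
      rw [adj_eq_star, hsa.star_eq]
    rw [this, ← cfc_comp' Real.sqrt (fun t : ℝ => t * t) D (by fun_prop) (by fun_prop)]
    conv_rhs => rw [← cfc_id' ℝ D]
    refine cfc_congr fun t ht => ?_
    exact Real.sqrt_mul_self (spectrum_nonneg_of_nonneg hD0 ht)
  set R : H →L[ℂ] H := cfc Real.sqrt D with hRdef
  have hR : adj R = R := (cfc_predicate _ _ : IsSelfAdjoint _)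
  have hRR : R * R = D := by
    rw [hRdef, ← cfc_mul _ _ D (by fun_prop) (by fun_prop)]
    conv_rhs => rw [← cfc_id' ℝ D]
    refine cfc_congr fun t ht => ?_
    exact Real.mul_self_sqrt (spectrum_nonneg_of_nonneg hD0 ht)
  have hS : Summable fun j => ‖R (e j)‖ ^ 2 := by
    unfold IsTraceClass at htc
    rw [habs] at htc
    convert htc using 2 with j
    rw [← hRR, ← inner_self_eq_norm_sq (𝕜 := ℂ), mul_apply_eq_comp,
      ← ContinuousLinearMap.adjoint_inner_left R (R (e j)) (e j), hR]
    rfl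
  have := tcb_base e R hR hS
  rw [hRR] at this
  exact ⟨_, tsum_nonneg fun _ => by positivity, this⟩

end ops

section duhamel
variable {ι : Type*} {e : HilbertBasis ι ℂ H}

lemma cont_integrand (x L : H →L[ℂ] H) : Continuous fun s : ℝ =>
    NormedSpace.exp (s • x) * L * NormedSpace.exp ((-s) • x) := by
  have h1 : Continuous fun s : ℝ => NormedSpace.exp (s • x) :=
    continuous_iff_continuousAt.mpr fun s =>
      (hasDerivAt_exp_smul_const (𝕂 := ℝ) x s).continuousAt
  have h2 : Continuous fun s : ℝ => NormedSpace.exp ((-s) • x) := h1.comp continuous_neg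
  exact (h1.mul continuous_const).mul h2

lemma duhamel (x K : H →L[ℂ] H) :
    NormedSpace.exp x * K * NormedSpace.exp (-x) - K =
      ∫ s in (0:ℝ)..1, NormedSpace.exp (s • x) * (x * K - K * x) * NormedSpace.exp ((-s) • x) := by
  have hd : ∀ s : ℝ, HasDerivAt
      (fun s : ℝ => NormedSpace.exp (s • x) * K * NormedSpace.exp ((-s) • x))
      (NormedSpace.exp (s • x) * (x * K - K * x) * NormedSpace.exp ((-s) • x)) s := by
    intro s
    have h1 := hasDerivAt_exp_smul_const (𝕂 := ℝ) x s
    have h2 := (hasDerivAt_exp_smul_const' (𝕂 := ℝ) x (-s)).scomp s (hasDerivAt_neg s)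
    have h3 := (h1.mul_const K).mul h2
    refine h3.congr_deriv ?_
    simp only [Function.comp_apply]
    rw [neg_smul (1 : ℝ), one_smul]
    noncomm_ring
  rw [intervalIntegral.integral_eq_sub_of_hasDerivAt (fun s _ => hd s)
    ((cont_integrand x _).intervalIntegrable _ _)]
  simp [NormedSpace.exp_zero]

lemma skew_smul {x : H →L[ℂ] H} (hx : star x = -x) (s : ℝ) : star (s • x) = -(s • x) := by
  rw [star_smul, hx, star_trivial, smul_neg]

lemma exp_star {x : H →L[ℂ] H} (hx : star x = -x) :
    star (NormedSpace.exp x) = NormedSpace.exp (-x) := by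
  rw [← hx, NormedSpace.star_exp]

lemma exp_neg_mul (x : H →L[ℂ] H) : NormedSpace.exp (-x) * NormedSpace.exp x = 1 := by
  let +nondep : NormedAlgebra ℚ (H →L[ℂ] H) := .restrictScalars ℚ ℂ (H →L[ℂ] H)
  rw [← NormedSpace.exp_add_of_commute (Commute.neg_left (Commute.refl x)), neg_add_cancel,
    NormedSpace.exp_zero]

lemma exp_mul_neg (x : H →L[ℂ] H) : NormedSpace.exp x * NormedSpace.exp (-x) = 1 := by
  simpa using exp_neg_mul (-x)

lemma norm_exp_le {x : H →L[ℂ] H} (hx : star x = -x) : ‖NormedSpace.exp x‖ ≤ 1 := by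
  have h := CStarRing.norm_star_mul_self (x := NormedSpace.exp x)
  rw [exp_star hx, exp_neg_mul] at h
  have h1 : ‖(1 : H →L[ℂ] H)‖ ≤ 1 := ContinuousLinearMap.norm_id_le
  nlinarith [norm_nonneg (NormedSpace.exp x)]

lemma TCB.conj {M : ℝ} (hM : 0 ≤ M) {x K : H →L[ℂ] H} (hx : star x = -x)
    (h : TCB e M (x * K - K * x)) :
    TCB e M (NormedSpace.exp x * K * NormedSpace.exp (-x) - K) ∧
    trace e (NormedSpace.exp x * K * NormedSpace.exp (-x) - K) = trace e (x * K - K * x) := by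
  rw [duhamel, intervalIntegral.integral_of_le zero_le_one]
  have hF : Integrable (fun s : ℝ => NormedSpace.exp (s • x) * (x * K - K * x) *
      NormedSpace.exp ((-s) • x)) (volume.restrict (Set.Ioc (0:ℝ) 1)) :=
    ((cont_integrand x _).integrableOn_Icc (a := 0) (b := 1)).mono_set Set.Ioc_subset_Icc_self
  have hm : Integrable (fun _ : ℝ => M) (volume.restrict (Set.Ioc (0:ℝ) 1)) :=
    integrable_const M
  obtain ⟨h1, h2⟩ := TCB.integral (e := e) hF hm fun s => by
    refine (h.mul hM (NormedSpace.exp (s • x)) (NormedSpace.exp ((-s) • x))).mono ?_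
    have a1 := norm_exp_le (skew_smul hx s)
    have a2 := norm_exp_le (skew_smul hx (-s))
    have : ‖NormedSpace.exp (s • x)‖ * ‖NormedSpace.exp ((-s) • x)‖ ≤ 1 * 1 := by gcongr
    nlinarith
  constructor
  · simpa using h1
  · rw [h2]
    have : ∀ s : ℝ, trace e (NormedSpace.exp (s • x) * (x * K - K * x) *
      NormedSpace.exp ((-s) • x)) = trace e (x * K - K * x) := fun s => by
      rw [h.2, neg_smul, exp_neg_mul, one_mul]
    simp only [this]
    simp

lemma TCB.comm_exp {M : ℝ} (hM : 0 ≤ M) {x K : H →L[ℂ] H} (hx : star x = -x)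
    (h : TCB e M (x * K - K * x)) :
    TCB e M (NormedSpace.exp x * K - K * NormedSpace.exp x) := by
  have h1 := (TCB.conj hM hx h).1.mul hM 1 (NormedSpace.exp x)
  rw [one_mul, sub_mul, mul_assoc _ _ (NormedSpace.exp x), exp_neg_mul, mul_one] at h1
  refine h1.mono ?_
  have a1 := norm_exp_le hx
  have a2 : ‖(1 : H →L[ℂ] H)‖ ≤ 1 := ContinuousLinearMap.norm_id_le
  have : ‖(1 : H →L[ℂ] H)‖ * ‖NormedSpace.exp x‖ ≤ 1 * 1 := by gcongr
  nlinarith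

end duhamel

section funcalc

lemma goodFun_continuous {ψ : ℝ → ℂ} (h : GoodFun ψ) : Continuous ψ := by
  rcases h with ⟨g, hg, -, hψ⟩ | ⟨p, hp⟩
  · simp only [smul_eq_mul] at hψ
    rw [show ψ = _ from funext hψ]
    refine Continuous.fun_const_smul ?_ _
    refine continuous_of_dominated (bound := fun α => ‖g α‖) ?_ ?_ hg.norm ?_
    · intro β
      refine AEStronglyMeasurable.mul ?_ hg.1
      exact Continuous.aestronglyMeasurable (by fun_prop)
    · intro β
      refine .of_forall fun α => ?_
      rw [norm_mul, Complex.norm_exp]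
      simp
    · refine .of_forall fun α => ?_
      fun_prop
  · rw [show ψ = _ from funext hp]
    fun_prop

lemma fc_id {Y : H →L[ℂ] H} (hY : IsSelfAdjoint Y) : fc (fun t => (t : ℂ)) Y = Y := by
  unfold fc
  have : IsStarNormal Y := hY.isStarNormal
  conv_rhs => rw [← cfc_id' ℂ Y]
  refine cfc_congr fun z hz => ?_
  exact (hY.mem_spectrum_eq_re hz).symm

lemma fc_selfAdjoint {Y : H →L[ℂ] H} (hY : IsSelfAdjoint Y) {ψ : ℝ → ℂ}
    (hreal : ∀ t : ℝ, (ψ t).im = 0) : IsSelfAdjoint (fc ψ Y) := by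
  unfold fc IsSelfAdjoint
  rw [← cfc_star]
  refine cfc_congr fun z hz => ?_
  exact Complex.conj_eq_iff_im.mpr (hreal _)

lemma fc_exp {Y : H →L[ℂ] H} (hY : IsSelfAdjoint Y) {ψ : ℝ → ℂ} (hψ : Continuous ψ) (s : ℝ) :
    expIpsi ψ s Y = NormedSpace.exp (s • (Complex.I • fc ψ Y)) := by
  have hn : IsStarNormal Y := hY.isStarNormal
  have h1 : s • (Complex.I • fc ψ Y) = cfc (fun z : ℂ => Complex.I * (s : ℂ) * ψ z.re) Y := by
    rw [cfc_const_mul _ _ Y (by fun_prop), ← Complex.coe_smul, smul_smul, mul_comm]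
    rfl
  have h2 : IsStarNormal (cfc (fun z : ℂ => Complex.I * (s : ℂ) * ψ z.re) Y) := cfc_predicate _ _
  rw [h1, ← CFC.complex_exp_eq_normedSpace_exp h2, ← cfc_comp' _ _ Y (by fun_prop) (by fun_prop)]
  rfl

lemma skew_I {A : H →L[ℂ] H} (hA : IsSelfAdjoint A) :
    star (Complex.I • A) = -(Complex.I • A) := by
  rw [star_smul, hA.star_eq]
  simp

lemma fc_integral {Y : H →L[ℂ] H} (hY : IsSelfAdjoint Y) {ψ g : ℝ → ℂ} (hg : Integrable g)
    (hψ : ∀ β : ℝ, ψ β = (Real.sqrt (2 * Real.pi))⁻¹ •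
      ∫ α : ℝ, Complex.exp (Complex.I * (α : ℂ) * (β : ℂ)) • g α) :
    fc ψ Y = (((Real.sqrt (2 * Real.pi))⁻¹ : ℝ) : ℂ) •
      ∫ α : ℝ, g α • NormedSpace.exp (α • (Complex.I • Y)) := by
  have hn : IsStarNormal Y := hY.isStarNormal
  set c : ℝ := (Real.sqrt (2 * Real.pi))⁻¹
  have hcont : ∀ α : ℝ, Continuous fun z : ℂ =>
      Complex.exp (Complex.I * (α : ℂ) * (z.re : ℂ)) * g α := fun α => by fun_prop
  let E : C(ℝ × spectrum ℂ Y, ℂ) :=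
    ⟨fun p => Complex.exp (Complex.I * (p.1 : ℂ) * ((p.2 : ℂ).re : ℂ)), by fun_prop⟩
  have hmk : ∀ α : ℝ, ContinuousMap.mkD ((spectrum ℂ Y).domRestrict
      (fun z : ℂ => Complex.exp (Complex.I * (α : ℂ) * (z.re : ℂ)) * g α)) 0 = g α • E.curry α := by
    intro α
    ext z
    rw [ContinuousMap.mkD_apply_of_continuousOn (hcont α).continuousOn]
    simp [E, mul_comm]
  have hint : Integrable (fun α : ℝ => g α • E.curry α) := by
    refine hg.smul_bdd 1 E.curry.continuous.aestronglyMeasurable (.of_forall fun α => ?_)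
    rw [ContinuousMap.norm_le _ zero_le_one]
    intro z
    simp only [E, ContinuousMap.curry_apply, ContinuousMap.coe_mk]
    rw [Complex.norm_exp]
    simp
  have h1 : cfc (fun z : ℂ => ∫ α : ℝ, Complex.exp (Complex.I * (α : ℂ) * (z.re : ℂ)) * g α) Y
      = ∫ α : ℝ, cfc (fun z : ℂ => Complex.exp (Complex.I * (α : ℂ) * (z.re : ℂ)) * g α) Y := by
    refine cfc_integral' (fun (α : ℝ) (z : ℂ) =>
      Complex.exp (Complex.I * (α : ℂ) * (z.re : ℂ)) * g α) Y
      (.of_forall fun α => (hcont α).continuousOn) ?_ hn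
    simp only [hmk]
    exact hint
  have h2 : ∀ α : ℝ, cfc (fun z : ℂ => Complex.exp (Complex.I * (α : ℂ) * (z.re : ℂ)) * g α) Y
      = g α • NormedSpace.exp (α • (Complex.I • Y)) := by
    intro α
    have h3 := fc_exp hY Complex.continuous_ofReal α
    rw [fc_id hY] at h3
    rw [← h3]
    simp only [mul_comm _ (g α)]
    rw [cfc_const_mul _ _ Y (by fun_prop)]
    rfl
  have h3 : ContinuousOn (fun z : ℂ => ∫ α : ℝ,
      Complex.exp (Complex.I * (α : ℂ) * (z.re : ℂ)) * g α) (spectrum ℂ Y) := by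
    refine Continuous.continuousOn ?_
    refine continuous_of_dominated (bound := fun α => ‖g α‖) ?_ ?_ hg.norm ?_
    · intro β
      refine AEStronglyMeasurable.mul ?_ hg.1
      exact Continuous.aestronglyMeasurable (by fun_prop)
    · intro β
      refine .of_forall fun α => ?_
      rw [norm_mul, Complex.norm_exp]
      simp
    · refine .of_forall fun α => ?_
      fun_prop
  simp only [h2] at h1
  rw [← h1, ← cfc_const_mul _ _ Y h3]
  unfold fc
  refine cfc_congr fun z _ => ?_
  simp only [hψ, smul_eq_mul, Complex.real_smul]

end funcalc

section main
variable {ι : Type*} {e : HilbertBasis ι ℂ H}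

lemma TCB.comm_pow {M : ℝ} (hM : 0 ≤ M) {Y K : H →L[ℂ] H}
    (h : TCB e M (Y * K - K * Y)) (n : ℕ) :
    ∃ N, 0 ≤ N ∧ TCB e N (Y ^ n * K - K * Y ^ n) := by
  induction n with
  | zero =>
    have := h.smul 0
    exact ⟨0, le_rfl, by simpa using this⟩
  | succ n ih =>
    obtain ⟨N, hN, h1⟩ := ih
    obtain ⟨N1, hN1, h2⟩ := h.mulLeft hM (Y ^ n)
    obtain ⟨N2, hN2, h3⟩ := h1.mulRight hN Y
    refine ⟨N1 + N2, by positivity, ?_⟩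
    convert h2.add h3 using 1
    rw [pow_succ]
    noncomm_ring

lemma TCB.comm_poly {M : ℝ} (hM : 0 ≤ M) {Y K : H →L[ℂ] H}
    (h : TCB e M (Y * K - K * Y)) (p : Polynomial ℂ) :
    ∃ N, 0 ≤ N ∧ TCB e N (Polynomial.aeval Y p * K - K * Polynomial.aeval Y p) := by
  induction p using Polynomial.induction_on' with
  | add p q hp hq =>
    obtain ⟨N1, hN1, h1⟩ := hp
    obtain ⟨N2, hN2, h2⟩ := hq
    refine ⟨N1 + N2, by positivity, ?_⟩
    convert h1.add h2 using 1
    rw [map_add]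
    noncomm_ring
  | monomial n a =>
    obtain ⟨N, hN, h1⟩ := TCB.comm_pow hM h n
    refine ⟨‖a‖ * N, by positivity, ?_⟩
    convert h1.smul a using 1
    rw [Polynomial.aeval_monomial, ← Algebra.smul_def, smul_mul_assoc, mul_smul_comm, smul_sub]

lemma fc_conj {X x : H →L[ℂ] H} (hX : IsSelfAdjoint X) (hx : star x = -x) {φ : ℝ → ℂ}
    (hφ : Continuous φ) :
    fc φ (NormedSpace.exp x * X * NormedSpace.exp (-x)) =
      NormedSpace.exp x * fc φ X * NormedSpace.exp (-x) := by
  let u : unitary (H →L[ℂ] H) := ⟨NormedSpace.exp x, by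
    rw [Unitary.mem_iff, exp_star hx]
    exact ⟨exp_neg_mul x, exp_mul_neg x⟩⟩
  have hu : ∀ A : H →L[ℂ] H, Unitary.conjStarAlgAut ℂ (H →L[ℂ] H) u A
      = NormedSpace.exp x * A * NormedSpace.exp (-x) := fun A => by
    rw [Unitary.conjStarAlgAut_apply, ← exp_star hx]
  have hn : IsStarNormal X := hX.isStarNormal
  have hc : Continuous (Unitary.conjStarAlgAut ℂ (H →L[ℂ] H) u) := by
    rw [show ⇑(Unitary.conjStarAlgAut ℂ (H →L[ℂ] H) u) = _ from funext hu]
    fun_prop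
  have hn2 : IsStarNormal (Unitary.conjStarAlgAut ℂ (H →L[ℂ] H) u X) := by
    have : IsSelfAdjoint (Unitary.conjStarAlgAut ℂ (H →L[ℂ] H) u X) := by
      rw [hu, ← exp_star hx]
      exact hX.conjugate _
    exact this.isStarNormal
  have := StarAlgHomClass.map_cfc (S := ℂ) (Unitary.conjStarAlgAut ℂ (H →L[ℂ] H) u)
    (fun z : ℂ => φ z.re) X (by fun_prop) hc hn hn2
  rw [hu, hu] at this
  exact this.symm

lemma TCB.comm_fc {M : ℝ} (hM : 0 ≤ M) {Y K : H →L[ℂ] H} (hY : IsSelfAdjoint Y)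
    (h : TCB e M (Y * K - K * Y)) {ψ : ℝ → ℂ} (hψ : GoodFun ψ) :
    ∃ N, 0 ≤ N ∧ TCB e N (fc ψ Y * K - K * fc ψ Y) := by
  rcases hψ with ⟨g, hg, hg2, hψ⟩ | ⟨p, hp⟩
  · rw [fc_integral hY hg hψ]
    set c : ℂ := (((Real.sqrt (2 * Real.pi))⁻¹ : ℝ) : ℂ)
    have hW : Continuous fun α : ℝ => NormedSpace.exp (α • (Complex.I • Y)) :=
      continuous_iff_continuousAt.mpr fun s =>
        (hasDerivAt_exp_smul_const (𝕂 := ℝ) (Complex.I • Y) s).continuousAt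
    have hI : Integrable fun α : ℝ => g α • NormedSpace.exp (α • (Complex.I • Y)) :=
      hg.smul_bdd 1 hW.aestronglyMeasurable
        (.of_forall fun α => norm_exp_le (skew_smul (skew_I hY) α))
    have e1 : (c • ∫ α : ℝ, g α • NormedSpace.exp (α • (Complex.I • Y))) * K
        - K * (c • ∫ α : ℝ, g α • NormedSpace.exp (α • (Complex.I • Y)))
        = c • ∫ α : ℝ, g α • (NormedSpace.exp (α • (Complex.I • Y)) * K
          - K * NormedSpace.exp (α • (Complex.I • Y))) := by
      rw [smul_mul_assoc, mul_smul_comm, ← smul_sub, ← integral_mul_const_of_integrable hI,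
        ← integral_const_mul_of_integrable hI, ← integral_sub (hI.mul_const K) (hI.const_mul K)]
      simp only [smul_sub, smul_mul_assoc, mul_smul_comm]
    rw [e1]
    have hI2 : Integrable fun α : ℝ => g α • (NormedSpace.exp (α • (Complex.I • Y)) * K
          - K * NormedSpace.exp (α • (Complex.I • Y))) := by
      have := (hI.mul_const K).sub (hI.const_mul K)
      refine this.congr (.of_forall fun α => ?_)
      simp only [Pi.sub_apply, smul_sub, smul_mul_assoc, mul_smul_comm]
    have hm : Integrable fun α : ℝ => ‖α • g α‖ * M := hg2.norm.mul_const M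
    have hT : ∀ α : ℝ, TCB e (‖α • g α‖ * M) (g α • (NormedSpace.exp (α • (Complex.I • Y)) * K
          - K * NormedSpace.exp (α • (Complex.I • Y)))) := by
      intro α
      have h1 := h.smul ((α : ℂ) * Complex.I)
      have h2 : ((α : ℂ) * Complex.I) • (Y * K - K * Y)
          = (α • (Complex.I • Y)) * K - K * (α • (Complex.I • Y)) := by
        rw [← Complex.coe_smul, smul_smul, smul_mul_assoc, mul_smul_comm, ← smul_sub]
      rw [h2] at h1
      have h3 := (TCB.comm_exp (by positivity) (skew_smul (skew_I hY) α) h1).smul (g α)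
      refine h3.mono (le_of_eq ?_)
      rw [norm_smul, norm_mul, Complex.norm_real, Complex.norm_I]
      ring
    have h4 := (TCB.integral (e := e) hI2 hm hT).1.smul c
    exact ⟨_, mul_nonneg (norm_nonneg _) (integral_nonneg fun α => by positivity), h4⟩
  · have hn : IsStarNormal Y := hY.isStarNormal
    have h1 : fc ψ Y = Polynomial.aeval Y p := by
      rw [← cfc_polynomial p Y]
      unfold fc
      refine cfc_congr fun z hz => ?_
      simp only [hp]
      rw [← hY.mem_spectrum_eq_re hz]
    rw [h1]
    exact TCB.comm_poly hM h p

end main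

theorem statement7 {ι : Type*} (e : HilbertBasis ι ℂ H) (X Y D2 : H →L[ℂ] H)
    (a b : ℝ) (hA : AssumptionA e X Y D2 a b)
    (ψ : ℝ → ℂ) (hψ : GoodFun ψ) (hreal : ∀ t : ℝ, (ψ t).im = 0) :
    IsTraceClass e (expIpsi ψ 1 Y * X * expIpsi ψ (-1) Y - X) ∧
    expIpsi ψ 1 Y * X * expIpsi ψ (-1) Y - X =
      Complex.I • ∫ s in (0:ℝ)..1,
        expIpsi ψ s Y * (fc ψ Y * X - X * fc ψ Y) * expIpsi ψ (-s) Y ∧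
    ∀ φ : ℝ → ℂ, GoodFun φ →
      IsTraceClass e (fc φ (expIpsi ψ 1 Y * X * expIpsi ψ (-1) Y) - fc φ X) ∧
      trace e (fc φ (expIpsi ψ 1 Y * X * expIpsi ψ (-1) Y) - fc φ X) =
        Complex.I * trace e (fc ψ Y * fc φ X - fc φ X * fc ψ Y) := by
  have hψc := goodFun_continuous hψ
  have hAsa := fc_selfAdjoint hA.hY hreal
  have hx := skew_I hAsa
  have hU : ∀ s : ℝ, expIpsi ψ s Y = NormedSpace.exp (s • (Complex.I • fc ψ Y)) :=
    fun s => fc_exp hA.hY hψc s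
  set x : H →L[ℂ] H := Complex.I • fc ψ Y with hxdef
  have hxK : ∀ K : H →L[ℂ] H, x * K - K * x = Complex.I • (fc ψ Y * K - K * fc ψ Y) := fun K => by
    rw [hxdef, smul_mul_assoc, mul_smul_comm, smul_sub]
  have hconj : ∀ K, expIpsi ψ 1 Y * K * expIpsi ψ (-1) Y =
      NormedSpace.exp x * K * NormedSpace.exp (-x) := fun K => by
    rw [hU, hU, one_smul, neg_smul, one_smul]
  obtain ⟨M, hM, hD⟩ := tcb_of_pos (e := e) D2 hA.hpos hA.htc
  have hYX : Y * X - X * Y = Complex.I • D2 := by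
    have h2 := congrArg (fun A => (Complex.I / 2) • A) hA.hD2
    simp only [smul_smul] at h2
    have c1 : Complex.I / 2 * 2 = Complex.I := by ring
    have c2 : Complex.I / 2 * (-2 * Complex.I) = 1 := by
      have := Complex.I_mul_I
      linear_combination -this
    rw [c1, c2, one_smul] at h2
    exact h2.symm
  have h0 : TCB e M (Y * X - X * Y) := by
    rw [hYX]
    simpa using hD.smul Complex.I
  obtain ⟨N, hN, h1⟩ := TCB.comm_fc hM hA.hY h0 hψ
  -- the commutator of `ψ(Y)` with any good function of `X`
  have hcomm : ∀ φ : ℝ → ℂ, GoodFun φ →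
      ∃ L, 0 ≤ L ∧ TCB e L (x * fc φ X - fc φ X * x) := by
    intro φ hφ
    have h2 : TCB e N (X * fc ψ Y - fc ψ Y * X) := by
      have := h1.smul (-1)
      simpa using this
    obtain ⟨L, hL, h3⟩ := TCB.comm_fc hN hA.hX h2 hφ
    refine ⟨L, hL, ?_⟩
    have h4 := h3.smul (-Complex.I)
    rw [hxK, ← neg_sub, smul_neg, ← neg_smul]
    simpa using h4
  have hXx : TCB e N (x * X - X * x) := by
    rw [hxK]
    simpa using h1.smul Complex.I
  refine ⟨?_, ?_, ?_⟩
  · rw [hconj]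
    exact (TCB.conj hN hx hXx).1.isTraceClass
  · rw [hconj, duhamel, ← intervalIntegral.integral_smul]
    refine intervalIntegral.integral_congr fun s _ => ?_
    simp only [hU, hxK, mul_smul_comm, smul_mul_assoc]
  · intro φ hφ
    obtain ⟨L, hL, h3⟩ := hcomm φ hφ
    obtain ⟨h5, h6⟩ := TCB.conj hL hx h3
    rw [hconj, fc_conj hA.hX hx (goodFun_continuous hφ)]
    refine ⟨h5.isTraceClass, ?_⟩
    rw [h6, hxK, trace_smul]

end HHCP
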